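/- arXiv:2410.19242 — 3 statements merged into one kernel-verified Lean document; each statement's English description precedes it below -/
import Mathlib

section
/- Let f = x_{i_1}⋯x_{i_r} (1 ≤ i_1 < ⋯ < i_r ≤ m) and let g be the i-th shortened monomial in the bit-reversal shortening order (1 ≤ i ≤ N). If g is a factor of f, then the set T_S^c(f, i−1) ∖ T_S^c(f, i) of newly removed polynomials consists exactly of the polynomials ∏_{j=1}^r (x_{i_j} + Σ_{k∈B(f,j)} a_{i_j,k} x_k + a_{i_j,0}) whose constant coefficients satisfy a_{i_j,0} = 1 for every i_j such that x_{i_j} does not divide g and a_{i_j,0} = 0 for every i_j such that x_{i_j} divides g (all other coefficients a_{i_j,k} arbitrary); in particular |T_S^c(f, i−1) ∖ T_S^c(f, i)| = λ_f / 2^r. -/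
open Finset

/-- Points of 𝔽₂^m (exponent/evaluation index vectors), 0-based coordinates:
coordinate `i : Fin m` corresponds to the paper's variable `x_{i+1}`. -/
abbrev Pt (m : ℕ) := Fin m → ZMod 2

/-- Multilinear polynomials over 𝔽₂ in x_1,…,x_m, represented (bijectively) by
their evaluation functions 𝔽₂^m → 𝔽₂. -/
abbrev BPoly (m : ℕ) := Pt m → ZMod 2

/-- D(a) = Σ_{i=1}^m 2^{i-1}(a_i ⊕ 1) + 1. -/
def Dnat {m : ℕ} (a : Pt m) : ℕ := (∑ i : Fin m, 2 ^ (i : ℕ) * (1 - (a i).val)) + 1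

/-- D(a_m,…,a_1) = Σ_{i=1}^m 2^{m-i}(a_i ⊕ 1) + 1 (the bit-reversed index). -/
def Drev {m : ℕ} (a : Pt m) : ℕ := (∑ i : Fin m, 2 ^ (m - 1 - (i : ℕ)) * (1 - (a i).val)) + 1

/-- Hamming weight of the window ev(p)_{[s,t]} (positions s..t, 1-based). -/
def wtIn {m : ℕ} (p : BPoly m) (s t : ℕ) : ℕ :=
  (Finset.univ.filter (fun a : Pt m => s ≤ Dnat a ∧ Dnat a ≤ t ∧ p a = 1)).card

/-- Hamming weight of ev(p). -/
def wt {m : ℕ} (p : BPoly m) : ℕ :=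
  (Finset.univ.filter (fun a : Pt m => p a = 1)).card

/-- T(f) for the monomial f with (0-based) index set S:
all products ∏_{j∈S} (x_j + Σ_{k∈B(f,j)} a_{j,k} x_k + a_{j,0}),
where B(f,j) = {k < j : k ∉ S}. -/
def Tset {m : ℕ} (S : Finset (Fin m)) : Set (BPoly m) :=
  {p | ∃ (c : Fin m → Fin m → ZMod 2) (c0 : Fin m → ZMod 2),
    p = fun x => ∏ j ∈ S,
      (x j + (∑ k ∈ Finset.univ.filter (fun k => k < j ∧ k ∉ S), c j k * x k) + c0 j)}

/-- λ_f = 2^{Σ_{t=1}^r (i_t - t + 1)} (here with 0-based sorted indices: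
the t-th smallest element e_t of S contributes e_t - t + 1, t = 0,…,r-1). -/
def lam {m : ℕ} (S : Finset (Fin m)) : ℕ :=
  2 ^ ∑ t : Fin S.card, (((S.orderIsoOfFin rfl t : Fin m) : ℕ) - (t : ℕ) + 1)

/-- Support of an exponent vector, i.e. the index set of the monomial it encodes. -/
def suppOf {m : ℕ} (b : Pt m) : Finset (Fin m) :=
  Finset.univ.filter (fun k => b k = 1)

/-- Coefficient of the monomial with index set S in the multilinear expansion of p
(Möbius inversion over 𝔽₂: c_S = Σ_{a with supp a ⊆ S} p(a)). -/
def coeff {m : ℕ} (S : Finset (Fin m)) (p : BPoly m) : ZMod 2 :=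
  ∑ a ∈ Finset.univ.filter (fun a : Pt m => ∀ i, a i = 1 → i ∈ S), p a

/-- T_S^c(f,i): members of T(f) whose coefficients vanish on each of the first i
monomials in the bit-reversal shortening order (g is among the first i shortened
monomials iff Drev g ≥ 2^m - i + 1). -/
def TSc {m : ℕ} (S : Finset (Fin m)) (i : ℕ) : Set (BPoly m) :=
  {p | p ∈ Tset S ∧ ∀ b : Pt m, 2 ^ m - i + 1 ≤ Drev b → coeff (suppOf b) p = 0}

/-- Exponent vector of the monomial with index set S. -/
def indOf {m : ℕ} (S : Finset (Fin m)) : Pt m := fun k => if k ∈ S then 1 else 0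

/-- β_f(i): number of monomials among the first i shortened (bit-reversal order)
that are factors of the monomial with index set S. -/
noncomputable def betaf {m : ℕ} (S : Finset (Fin m)) (i : ℕ) : ℕ :=
  {b : Pt m | 2 ^ m - i + 1 ≤ Drev b ∧ ∀ k, b k = 1 → k ∈ S}.ncard

/-- The partial order ≼ on monomials (given by their index sets):
x_{i_1}…x_{i_t} ≼ x_{j_1}…x_{j_s} iff t ≤ s and i_{t-l} ≤ j_{s-l} for 0 ≤ l ≤ t-1. -/
def MonLE {m : ℕ} (S T : Finset (Fin m)) : Prop :=
  S.card ≤ T.card ∧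
    List.Forall₂ (· ≤ ·) (S.sort (· ≤ ·)) (List.drop (T.card - S.card) (T.sort (· ≤ ·)))

/-- Evaluation vector of the monomial with index set S. -/
def evMon {m : ℕ} (S : Finset (Fin m)) : BPoly m := fun a => ∏ i ∈ S, a i

/-- The monomial code C(ℐ): the 𝔽₂-span of the evaluation vectors of ℐ. -/
def Ccode {m : ℕ} (ℐ : Finset (Finset (Fin m))) : Submodule (ZMod 2) (BPoly m) :=
  Submodule.span (ZMod 2) (evMon '' (↑ℐ : Set (Finset (Fin m))))

/-- N_f(w,a) = |{p ∈ T(f) : wt(p_{[1,a]}) = w}|. -/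
noncomputable def Nfun {m : ℕ} (S : Finset (Fin m)) (w a : ℕ) : ℕ :=
  {p : BPoly m | p ∈ Tset S ∧ wtIn p 1 a = w}.ncard

/-- P_f(w,i) = |{p ∈ T(f) : wt(p_{[i+1,N]}) = w}|. -/
noncomputable def Pf {m : ℕ} (S : Finset (Fin m)) (w i : ℕ) : ℕ :=
  {p : BPoly m | p ∈ Tset S ∧ wtIn p (i + 1) (2 ^ m) = w}.ncard

/-- The polynomial `∏_{j ∈ S} (x_j + ∑_{k < j, k ∉ S} c j k * x_k + c0 j)`. -/
def affineProd {m : ℕ} (S : Finset (Fin m)) (c : Fin m → Fin m → ZMod 2) (c0 : Fin m → ZMod 2) :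
    BPoly m :=
  fun x => ∏ j ∈ S,
    (x j + (∑ k ∈ Finset.univ.filter (fun k => k < j ∧ k ∉ S), c j k * x k) + c0 j)

theorem ZMod.two_eq_zero_or_one (z : ZMod 2) : z = 0 ∨ z = 1 := by
  revert z; decide

theorem ZMod.two_eq_zero_of_ne_one {z : ZMod 2} (h : z ≠ 1) : z = 0 :=
  (ZMod.two_eq_zero_or_one z).resolve_right h

theorem Drev_lt_of_first_diff {m : ℕ} {a b : Pt m} (i : Fin m) (hlt : ∀ k < i, a k = b k)
    (ha : a i = 0) (hb : b i = 1) : Drev b < Drev a := by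
  unfold Drev
  have hgeom : ∑ k ∈ univ.filter (fun k : Fin m => i < k), 2 ^ (m - 1 - (k : ℕ))
      < 2 ^ (m - 1 - (i : ℕ)) := by
    rw [← Finset.sum_image (s := univ.filter (fun k : Fin m => i < k))
      (g := fun k : Fin m => m - 1 - (k : ℕ)) (f := fun n => 2 ^ n)]
    · apply Nat.geomSum_lt le_rfl
      intro n hn
      simp only [mem_image, mem_filter, mem_univ, true_and] at hn
      obtain ⟨k, hk, rfl⟩ := hn
      have := k.isLt
      have : (i : ℕ) < k := hk
      omega
    · intro k _ l _ h
      have hk := k.isLt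
      have hl := l.isLt
      ext
      simp only at h
      omega
  have hsplit : ∀ F : Fin m → ℕ, ∑ k, F k =
      ∑ k ∈ univ.filter (fun k : Fin m => k < i), F k + F i +
        ∑ k ∈ univ.filter (fun k : Fin m => i < k), F k := by
    intro F
    rw [← Finset.sum_filter_add_sum_filter_not univ (fun k : Fin m => k < i), add_assoc]
    congr 1
    rw [← Finset.sum_insert (by simp)]
    congr 1
    ext k
    simp only [mem_filter, mem_univ, true_and, mem_insert, not_lt, le_iff_eq_or_lt, eq_comm]
  rw [hsplit, hsplit (fun k => 2 ^ (m - 1 - (k : ℕ)) * (1 - (a k).val))]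
  have h1 : ∑ k ∈ univ.filter (fun k : Fin m => k < i), 2 ^ (m - 1 - (k : ℕ)) * (1 - (b k).val) =
      ∑ k ∈ univ.filter (fun k : Fin m => k < i), 2 ^ (m - 1 - (k : ℕ)) * (1 - (a k).val) := by
    refine Finset.sum_congr rfl fun k hk => ?_
    rw [hlt k (by simpa using hk)]
  have h2 : ∑ k ∈ univ.filter (fun k : Fin m => i < k), 2 ^ (m - 1 - (k : ℕ)) * (1 - (b k).val) ≤
      ∑ k ∈ univ.filter (fun k : Fin m => i < k), 2 ^ (m - 1 - (k : ℕ)) := by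
    refine Finset.sum_le_sum fun k _ => ?_
    calc _ ≤ 2 ^ (m - 1 - (k : ℕ)) * 1 := Nat.mul_le_mul_left _ (Nat.sub_le _ _)
      _ = _ := mul_one _
  have h3 : (1 : ZMod 2).val = 1 := rfl
  simp only [h1, ha, hb, h3, ZMod.val_zero]
  omega

theorem exists_first_diff {m : ℕ} {a b : Pt m} (h : a ≠ b) :
    ∃ i, a i ≠ b i ∧ ∀ k < i, a k = b k := by
  obtain ⟨j, hj⟩ := Function.ne_iff.mp h
  obtain ⟨i, hi, hmin⟩ := (Set.toFinite {i | a i ≠ b i}).exists_minimal ⟨j, hj⟩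
  refine ⟨i, hi, fun k hk => ?_⟩
  by_contra hne
  exact absurd (hmin hne hk.le) (not_le.mpr hk)

theorem exists_first_diff_of_Drev_lt {m : ℕ} {a b : Pt m} (h : Drev b < Drev a) :
    ∃ i, a i = 0 ∧ b i = 1 ∧ ∀ k < i, a k = b k := by
  obtain ⟨i, hi, hlt⟩ := exists_first_diff (a := a) (b := b) (by rintro rfl; exact h.false)
  rcases ZMod.two_eq_zero_or_one (a i) with ha | ha
  · refine ⟨i, ha, ?_, hlt⟩
    rw [ha] at hi
    exact (ZMod.two_eq_zero_or_one (b i)).resolve_left hi.symm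
  · rw [ha] at hi
    have := Drev_lt_of_first_diff i (fun k hk => (hlt k hk).symm)
      (ZMod.two_eq_zero_of_ne_one hi.symm) ha
    omega

theorem Drev_injective {m : ℕ} : Function.Injective (Drev (m := m)) := by
  intro a b hab
  by_contra hne
  obtain ⟨i, hi, hlt⟩ := exists_first_diff hne
  rcases ZMod.two_eq_zero_or_one (a i) with ha | ha <;>
    rcases ZMod.two_eq_zero_or_one (b i) with hb | hb
  · exact hi (ha.trans hb.symm)
  · exact (Drev_lt_of_first_diff i hlt ha hb).ne hab.symm
  · exact (Drev_lt_of_first_diff i (fun k hk => (hlt k hk).symm) hb ha).ne hab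
  · exact hi (ha.trans hb.symm)

theorem Drev_anti {m : ℕ} {a b : Pt m} (h : ∀ k, a k = 1 → b k = 1) : Drev b ≤ Drev a := by
  by_contra! hlt
  obtain ⟨i, hb, ha, -⟩ := exists_first_diff_of_Drev_lt hlt
  exact zero_ne_one (hb.symm.trans (h i ha))

theorem coeff_suppOf {m : ℕ} (b : Pt m) (p : BPoly m) :
    coeff (suppOf b) p = ∑ a ∈ univ.filter (fun a : Pt m => ∀ i, a i = 1 → b i = 1), p a := by
  simp [coeff, suppOf]

/-- On points supported in `S`, the linear parts of the factors vanish. -/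
theorem affineProd_apply_of_supp {m : ℕ} {S : Finset (Fin m)} (c : Fin m → Fin m → ZMod 2)
    (c0 : Fin m → ZMod 2) {a : Pt m} (ha : ∀ k, a k = 1 → k ∈ S) :
    affineProd S c c0 a = ∏ j ∈ S, (a j + c0 j) := by
  refine Finset.prod_congr rfl fun j _ => ?_
  rw [Finset.sum_eq_zero, add_zero]
  intro k hk
  rw [ZMod.two_eq_zero_of_ne_one (fun h => (mem_filter.mp hk).2.2 (ha k h)), mul_zero]

theorem coeff_affineProd_eq_one {m : ℕ} {S : Finset (Fin m)} (c : Fin m → Fin m → ZMod 2)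
    {c0 : Fin m → ZMod 2} {b : Pt m} (hb : ∀ k, b k = 1 → k ∈ S)
    (hc : ∀ j ∈ S, c0 j = 1 + b j) : coeff (suppOf b) (affineProd S c c0) = 1 := by
  rw [coeff_suppOf, Finset.sum_eq_single b]
  · rw [affineProd_apply_of_supp c c0 hb]
    refine Finset.prod_eq_one fun j hj => ?_
    rw [hc j hj]
    generalize b j = z
    revert z; decide
  · intro a ha hne
    have ha' : ∀ k, a k = 1 → b k = 1 := (mem_filter.mp ha).2
    rw [affineProd_apply_of_supp c c0 fun k hk => hb k (ha' k hk)]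
    obtain ⟨j, hj⟩ := Function.ne_iff.mp hne
    have haj : a j = 0 := ZMod.two_eq_zero_of_ne_one fun h => hj (h.trans (ha' j h).symm)
    have hbj : b j = 1 := by
      rw [haj] at hj
      exact (ZMod.two_eq_zero_or_one (b j)).resolve_left hj.symm
    refine Finset.prod_eq_zero (hb j hbj) ?_
    rw [haj, hc j (hb j hbj), hbj]
    decide
  · intro h
    simp at h

theorem coeff_affineProd_eq_zero_of_Drev_lt {m : ℕ} {S : Finset (Fin m)}
    (c : Fin m → Fin m → ZMod 2) {c0 : Fin m → ZMod 2} {b d : Pt m} (hb : ∀ k, b k = 1 → k ∈ S)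
    (hc : ∀ j ∈ S, c0 j = 1 + b j) (hd : Drev b < Drev d) :
    coeff (suppOf d) (affineProd S c c0) = 0 := by
  obtain ⟨i, hdi, hbi, hlt⟩ := exists_first_diff_of_Drev_lt hd
  rw [coeff_suppOf]
  refine Finset.sum_eq_zero fun a ha => ?_
  have ha' : ∀ k, a k = 1 → d k = 1 := (mem_filter.mp ha).2
  refine Finset.prod_eq_zero (hb i hbi) ?_
  have hai : a i = 0 := ZMod.two_eq_zero_of_ne_one fun h => by
    simp [ha' i h] at hdi
  rw [Finset.sum_eq_zero, hai, hc i (hb i hbi), hbi]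
  · decide
  · intro k hk
    obtain ⟨-, hki, hkS⟩ := mem_filter.mp hk
    have : a k = 0 := ZMod.two_eq_zero_of_ne_one fun h =>
      hkS (hb k ((hlt k hki).symm.trans (ha' k h)))
    rw [this, mul_zero]

theorem eq_one_of_coeff_affineProd_ne_zero {m : ℕ} {S : Finset (Fin m)}
    {c : Fin m → Fin m → ZMod 2} {c0 : Fin m → ZMod 2} {b : Pt m} (hb : ∀ k, b k = 1 → k ∈ S)
    (h : coeff (suppOf b) (affineProd S c c0) ≠ 0) {j : Fin m} (hj : j ∈ S) (hbj : b j ≠ 1) :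
    c0 j = 1 := by
  by_contra hne
  apply h
  rw [coeff_suppOf]
  refine Finset.sum_eq_zero fun a ha => ?_
  have ha' : ∀ k, a k = 1 → b k = 1 := (mem_filter.mp ha).2
  rw [affineProd_apply_of_supp c c0 fun k hk => hb k (ha' k hk)]
  refine Finset.prod_eq_zero hj ?_
  rw [ZMod.two_eq_zero_of_ne_one hne,
    ZMod.two_eq_zero_of_ne_one fun h => hbj (ha' j h), add_zero]

theorem affineProd_eq_one_iff {m : ℕ} {S : Finset (Fin m)} {c : Fin m → Fin m → ZMod 2}
    {c0 : Fin m → ZMod 2} {x : Pt m} :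
    affineProd S c c0 x = 1 ↔ ∀ j ∈ S,
      x j + (∑ k ∈ univ.filter (fun k => k < j ∧ k ∉ S), c j k * x k) + c0 j = 1 := by
  refine ⟨fun h j hj => ?_, fun h => Finset.prod_eq_one h⟩
  by_contra hne
  rw [affineProd, Finset.prod_eq_zero hj (ZMod.two_eq_zero_of_ne_one hne)] at h
  exact zero_ne_one h

theorem affineProd_coeff_unique {m : ℕ} {S : Finset (Fin m)} {c c' : Fin m → Fin m → ZMod 2}
    {c0 : Fin m → ZMod 2} (h : affineProd S c c0 = affineProd S c' c0) {j k : Fin m}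
    (hj : j ∈ S) (hkj : k < j) (hk : k ∉ S) : c j k = c' j k := by
  classical
  let x : Pt m := fun l => if l ∈ S then 1 + (if k < l then c l k else 0) + c0 l
    else if l = k then 1 else 0
  have hsum : ∀ (e : Fin m → Fin m → ZMod 2) (l : Fin m),
      ∑ n ∈ univ.filter (fun n => n < l ∧ n ∉ S), e l n * x n = if k < l then e l k else 0 := by
    intro e l
    have hx : ∀ n ∈ univ.filter (fun n => n < l ∧ n ∉ S),
        e l n * x n = if n = k then e l n else 0 := by
      intro n hn
      simp [x, (mem_filter.mp hn).2.2]
    rw [Finset.sum_congr rfl hx, Finset.sum_ite_eq']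
    simp [hk]
  have hone : affineProd S c c0 x = 1 := by
    rw [affineProd_eq_one_iff]
    intro l hl
    rw [hsum]
    simp only [x, hl, if_true]
    generalize (if k < l then c l k else 0) = y
    generalize c0 l = z
    revert y z; decide
  have h1 := affineProd_eq_one_iff.mp hone j hj
  rw [h] at hone
  have h2 := affineProd_eq_one_iff.mp hone j hj
  rw [hsum, if_pos hkj] at h1 h2
  exact add_left_cancel (add_right_cancel (h1.trans h2.symm))

theorem ncard_range_affineProd {m : ℕ} (S : Finset (Fin m)) (c0 : Fin m → ZMod 2) :
    (Set.range fun c => affineProd S c c0).ncard =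
      2 ^ ∑ j ∈ S, (univ.filter (fun k : Fin m => k < j ∧ k ∉ S)).card := by
  classical
  let Q := S.sigma fun j => univ.filter (fun k : Fin m => k < j ∧ k ∉ S)
  let toCoeffs (q : Q → ZMod 2) (j k : Fin m) : ZMod 2 := if h : ⟨j, k⟩ ∈ Q then q ⟨⟨j, k⟩, h⟩ else 0
  have hmem : ∀ j k, (⟨j, k⟩ : Σ _ : Fin m, Fin m) ∈ Q ↔ j ∈ S ∧ k < j ∧ k ∉ S := by
    simp [Q]
  have hinj : Function.Injective fun q => affineProd S (toCoeffs q) c0 := by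
    intro q q' h
    funext ⟨⟨j, k⟩, hjk⟩
    obtain ⟨hj, hkj, hk⟩ := (hmem j k).mp hjk
    simpa [toCoeffs, hjk] using affineProd_coeff_unique h hj hkj hk
  have hrange : (Set.range fun c => affineProd S c c0) =
      Set.range fun q => affineProd S (toCoeffs q) c0 := by
    refine Set.Subset.antisymm ?_ ?_
    · rintro _ ⟨c, rfl⟩
      refine ⟨fun q => c q.1.1 q.1.2, funext fun x => ?_⟩
      refine Finset.prod_congr rfl fun j hj => ?_
      congr 2
      refine Finset.sum_congr rfl fun k hk => ?_
      have : (⟨j, k⟩ : Σ _ : Fin m, Fin m) ∈ Q := (hmem j k).mpr ⟨hj, (mem_filter.mp hk).2⟩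
      simp [toCoeffs, this]
    · rintro _ ⟨q, rfl⟩
      exact ⟨toCoeffs q, rfl⟩
  rw [hrange, ← Nat.card_coe_set_eq, Nat.card_range_of_injective hinj, Nat.card_eq_fintype_card,
    Fintype.card_fun, ZMod.card, Fintype.card_coe, Finset.card_sigma]

theorem card_filter_lt_notMem {m : ℕ} (S : Finset (Fin m)) (t : Fin S.card) :
    (univ.filter (fun k : Fin m => k < S.orderEmbOfFin rfl t ∧ k ∉ S)).card =
      (S.orderEmbOfFin rfl t : ℕ) - t := by
  have himg : S.filter (fun k => k < S.orderEmbOfFin rfl t) =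
      (Iio t).map (S.orderEmbOfFin rfl).toEmbedding := by
    ext k
    simp only [mem_filter, mem_map, mem_Iio]
    constructor
    · rintro ⟨hk, hlt⟩
      refine ⟨(S.orderIsoOfFin rfl).symm ⟨k, hk⟩, ?_, ?_⟩
      · rw [OrderIso.symm_apply_lt, ← Subtype.coe_lt_coe, Finset.coe_orderIsoOfFin_apply]
        exact hlt
      · simp [← Finset.coe_orderIsoOfFin_apply]
    · rintro ⟨s, hs, rfl⟩
      refine ⟨Finset.orderEmbOfFin_mem S rfl s, ?_⟩
      simpa using hs
  have hcard : (S.filter (fun k => k < S.orderEmbOfFin rfl t)).card = t := by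
    rw [himg, card_map, Fin.card_Iio]
  have hIio : (Iio (S.orderEmbOfFin rfl t)).card =
      (S.orderEmbOfFin rfl t : ℕ) := Fin.card_Iio _
  have hsdiff : univ.filter (fun k : Fin m => k < S.orderEmbOfFin rfl t ∧ k ∉ S) =
      Iio (S.orderEmbOfFin rfl t) \ S.filter (fun k => k < S.orderEmbOfFin rfl t) := by
    ext k
    simp only [mem_filter, mem_univ, true_and, mem_sdiff, mem_Iio]
    tauto
  rw [hsdiff, card_sdiff_of_subset, hcard, hIio]
  intro k hk
  simpa using (mem_filter.mp hk).2

theorem lam_eq {m : ℕ} (S : Finset (Fin m)) :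
    lam S = 2 ^ (∑ j ∈ S, (univ.filter (fun k : Fin m => k < j ∧ k ∉ S)).card) * 2 ^ S.card := by
  rw [lam, Finset.sum_add_distrib, pow_add]
  congr 2
  · rw [← Finset.sum_coe_sort S, ← (S.orderIsoOfFin rfl).toEquiv.sum_comp]
    exact Finset.sum_congr rfl fun t _ => (card_filter_lt_notMem S t).symm
  · simp

/-- if the i-th shortened monomial g (bit-reversal order) is a factor
of f, then T_S^c(f, i-1) ∖ T_S^c(f, i) consists exactly of the products
∏_{j∈S}(x_j + Σ_{k∈B(f,j)} a_{j,k}x_k + a_{j,0}) with constant coefficients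
a_{j,0} = 0 when x_j divides g and a_{j,0} = 1 otherwise (i.e. a_{j,0} = 1 + b_j),
all other coefficients arbitrary; in particular its cardinality is λ_f / 2^r. -/
theorem stmt2 (m r : ℕ) (hm : 1 ≤ m) (S : Finset (Fin m)) (hS : S.card = r)
    (i : ℕ) (hi1 : 1 ≤ i) (hiN : i ≤ 2 ^ m) (b : Pt m)
    (hb : Drev b = 2 ^ m - i + 1)
    (hfac : ∀ k, b k = 1 → k ∈ S) :
    TSc S (i - 1) \ TSc S i =
      {p : BPoly m | ∃ (c : Fin m → Fin m → ZMod 2) (c0 : Fin m → ZMod 2),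
        (∀ j ∈ S, c0 j = 1 + b j) ∧
        p = fun x => ∏ j ∈ S,
          (x j + (∑ k ∈ Finset.univ.filter (fun k => k < j ∧ k ∉ S), c j k * x k) + c0 j)} ∧
    (TSc S (i - 1) \ TSc S i).ncard = lam S / 2 ^ r := by
  have hset : TSc S (i - 1) \ TSc S i =
      {p : BPoly m | ∃ (c : Fin m → Fin m → ZMod 2) (c0 : Fin m → ZMod 2),
        (∀ j ∈ S, c0 j = 1 + b j) ∧ p = affineProd S c c0} := by
    ext p
    constructor
    · rintro ⟨⟨⟨c, c0, hp⟩, hprev⟩, hnot⟩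
      change p = affineProd S c c0 at hp
      subst hp
      have hex : ∃ d : Pt m, 2 ^ m - i + 1 ≤ Drev d ∧
          coeff (suppOf d) (affineProd S c c0) ≠ 0 := by
        by_contra! hall
        exact hnot ⟨⟨c, c0, rfl⟩, hall⟩
      obtain ⟨d, hd, hne⟩ := hex
      have hdb : d = b := by
        apply Drev_injective
        by_contra hdne
        exact hne (hprev d (by omega))
      subst hdb
      let h : Pt m := fun j => if j ∈ S then 1 + c0 j else 0
      have hhS : ∀ k, h k = 1 → k ∈ S := by
        intro k hk
        by_contra hkS
        simp [h, hkS] at hk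
      have hadd : ∀ z : ZMod 2, z = 1 + (1 + z) := by decide
      have hle : Drev d ≤ Drev h := by
        refine Drev_anti fun k hk => ?_
        by_contra hdk
        have h1 := eq_one_of_coeff_affineProd_ne_zero hfac hne (hhS k hk) hdk
        simp only [h, hhS k hk, if_true, h1] at hk
        exact absurd hk (by decide)
      have hh : coeff (suppOf h) (affineProd S c c0) = 1 :=
        coeff_affineProd_eq_one c hhS fun j hj => by
          simpa only [h, hj, if_true] using hadd (c0 j)
      have hhd : h = d := by
        apply Drev_injective
        by_contra hne'
        rw [hprev h (by omega)] at hh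
        exact zero_ne_one hh
      refine ⟨c, c0, fun j hj => ?_, rfl⟩
      rw [← hhd]
      simpa only [h, hj, if_true] using hadd (c0 j)
    · rintro ⟨c, c0, hc, rfl⟩
      refine ⟨⟨⟨c, c0, rfl⟩, fun d hd => ?_⟩, fun hmem => ?_⟩
      · exact coeff_affineProd_eq_zero_of_Drev_lt c hfac hc (by omega)
      · have h0 := hmem.2 b hb.ge
        rw [coeff_affineProd_eq_one c hfac hc] at h0
        exact one_ne_zero h0
  refine ⟨hset, ?_⟩
  have hrange : TSc S (i - 1) \ TSc S i =
      Set.range fun c => affineProd S c fun j => 1 + b j := by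
    rw [hset]
    ext p
    constructor
    · rintro ⟨c, c0, hc, rfl⟩
      refine ⟨c, funext fun x => Finset.prod_congr rfl fun j hj => ?_⟩
      rw [hc j hj]
    · rintro ⟨c, rfl⟩
      exact ⟨c, _, fun _ _ => rfl, rfl⟩
  rw [hrange, ncard_range_affineProd, lam_eq, hS, Nat.mul_div_cancel _ (by positivity)]
end

section
/- Let f = x_{i_1}⋯x_{i_t} with 1 ≤ i_1 < ⋯ < i_t ≤ m and t ≥ 2. Then for every a with 2^{i_t} < a ≤ 2^m and every integer w ≥ 2^{i_t−t}: N_f(w,a) = N_f(w − 2^{i_t−t}, a − 2^{i_t}); moreover N_f(w,a) = 0 for w < 2^{i_t−t}. -/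
open Finset

/-- The point whose `i`-th coordinate is the complement of the `i`-th binary digit of `e`. -/
def ptOfNat (m e : ℕ) : Pt m := fun i => if e.testBit i then 0 else 1

theorem sum_two_pow_mul_testBit (e m : ℕ) :
    ∑ i ∈ range m, 2 ^ i * (e.testBit i).toNat = e % 2 ^ m := by
  induction m with
  | zero => simp [Nat.mod_one]
  | succ m ih => rw [sum_range_succ, ih, Nat.mod_pow_succ, Nat.toNat_testBit]

theorem Dnat_ptOfNat {m e : ℕ} (he : e < 2 ^ m) : Dnat (ptOfNat m e) = e + 1 := by
  have h : ∀ i : Fin m, 2 ^ (i : ℕ) * (1 - (ptOfNat m e i).val)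
      = 2 ^ (i : ℕ) * (e.testBit i).toNat := by
    intro i
    unfold ptOfNat
    cases e.testBit i <;> simp [ZMod.val_one]
  rw [Dnat, Finset.sum_congr rfl fun i _ => h i,
    Fin.sum_univ_eq_sum_range (fun i => 2 ^ i * (e.testBit i).toNat), sum_two_pow_mul_testBit,
    Nat.mod_eq_of_lt he]

theorem exists_ptOfNat_eq {m : ℕ} (x : Pt m) : ∃ e < 2 ^ m, ptOfNat m e = x := by
  have hinj : Function.Injective fun e : Fin (2 ^ m) => ptOfNat m e := by
    intro e e' h
    have h' := congrArg Dnat h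
    simp only [Dnat_ptOfNat e.isLt, Dnat_ptOfNat e'.isLt] at h'
    exact Fin.ext (by omega)
  have hbij := (Fintype.bijective_iff_injective_and_card _).2 ⟨hinj, by simp [ZMod.card]⟩
  obtain ⟨e, he⟩ := hbij.2 x
  exact ⟨e, e.isLt, he⟩

theorem wtIn_one_eq_count {m a : ℕ} (p : BPoly m) (ha : a ≤ 2 ^ m) :
    wtIn p 1 a = Nat.count (fun e => p (ptOfNat m e) = 1) a := by
  rw [Nat.count_eq_card_filter_range, wtIn]
  symm
  refine Finset.card_bij (fun e _ => ptOfNat m e) ?_ ?_ ?_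
  · intro e he
    simp only [mem_filter, mem_range] at he
    simp only [mem_filter, mem_univ, true_and, Dnat_ptOfNat (he.1.trans_le ha)]
    exact ⟨by omega, by omega, he.2⟩
  · intro e he e' he' h
    simp only [mem_filter, mem_range] at he he'
    have h' := congrArg Dnat h
    rw [Dnat_ptOfNat (he.1.trans_le ha), Dnat_ptOfNat (he'.1.trans_le ha)] at h'
    omega
  · intro x hx
    obtain ⟨e, he, rfl⟩ := exists_ptOfNat_eq x
    simp only [mem_filter, mem_univ, true_and, Dnat_ptOfNat he] at hx
    exact ⟨e, by simp only [mem_filter, mem_range]; exact ⟨by omega, hx.2.2⟩, rfl⟩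

theorem ptOfNat_two_pow_add_of_lt {m k : ℕ} (e : ℕ) {i : Fin m} (hi : (i : ℕ) < k) :
    ptOfNat m (2 ^ k + e) i = ptOfNat m e i := by
  simp only [ptOfNat, Nat.testBit_two_pow_add_gt hi]

theorem ZMod.two_ne_zero_iff (z : ZMod 2) : z ≠ 0 ↔ z = 1 := by
  revert z; decide

theorem ZMod.two_zero_add_iff (z : ZMod 2) : 0 + z = 1 ↔ ¬ 1 + z = 1 := by
  revert z; decide

theorem count_congr_of_lt {P Q : ℕ → Prop} [DecidablePred P] [DecidablePred Q] {n : ℕ}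
    (h : ∀ e < n, (P e ↔ Q e)) : Nat.count P n = Nat.count Q n := by
  rw [Nat.count_eq_card_filter_range, Nat.count_eq_card_filter_range]
  congr 1
  exact Finset.filter_congr fun e he => h e (mem_range.1 he)

theorem count_triangular {m : ℕ} (S : Finset (Fin m)) (g : Fin m → Pt m → ZMod 2)
    (hg : ∀ j x y, (∀ i < j, x i = y i) → g j x = g j y) (k : ℕ) (hk : k ≤ m) :
    Nat.count (fun e => ∀ j ∈ S, (j : ℕ) < k → ptOfNat m e j + g j (ptOfNat m e) = 1) (2 ^ k)
      * 2 ^ (S.filter fun j : Fin m => (j : ℕ) < k).card = 2 ^ k := by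
  induction k with
  | zero => simp
  | succ k ih =>
    specialize ih (by omega)
    set P : ℕ → Prop := fun e => ∀ j ∈ S, (j : ℕ) < k →
      ptOfNat m e j + g j (ptOfNat m e) = 1
    set κ : Fin m := ⟨k, by omega⟩ with hκ
    have hgk : ∀ e (j : Fin m), (j : ℕ) ≤ k →
        g j (ptOfNat m (2 ^ k + e)) = g j (ptOfNat m e) := fun e j hj =>
      hg j _ _ fun i hi => ptOfNat_two_pow_add_of_lt e (lt_of_lt_of_le hi hj)
    have hper : ∀ e, P (2 ^ k + e) ↔ P e := by
      intro e
      refine forall_congr' fun j => imp_congr_right fun _ => imp_congr_right fun hj => ?_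
      rw [hgk e j hj.le, ptOfNat_two_pow_add_of_lt e hj]
    have hsplit : ∀ e, (∀ j ∈ S, (j : ℕ) < k + 1 → ptOfNat m e j + g j (ptOfNat m e) = 1) ↔
        P e ∧ (κ ∈ S → ptOfNat m e κ + g κ (ptOfNat m e) = 1) := by
      intro e
      constructor
      · exact fun h => ⟨fun j hj hjk => h j hj (by omega), fun hS => h κ hS (by simp [hκ])⟩
      · rintro ⟨h1, h2⟩ j hj hjk
        rcases Nat.lt_succ_iff_lt_or_eq.1 hjk with h | h
        · exact h1 j hj h
        · obtain rfl : j = κ := Fin.ext h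
          exact h2 hj
    simp only [hsplit]
    rw [show 2 ^ (k + 1) = 2 ^ k + 2 ^ k by ring, Nat.count_add]
    simp only [hper]
    by_cases hS : κ ∈ S
    · have hfilter : (S.filter fun j : Fin m => (j : ℕ) < k + 1)
          = insert κ (S.filter fun j : Fin m => (j : ℕ) < k) := by
        ext j
        simp only [mem_filter, mem_insert, Fin.ext_iff, hκ]
        constructor
        · rintro ⟨h1, h2⟩
          by_cases h : (j : ℕ) = k
          · exact Or.inl h
          · exact Or.inr ⟨h1, by omega⟩
        · rintro (h | h)
          · obtain rfl : j = κ := Fin.ext h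
            exact ⟨hS, by simp [hκ]⟩
          · exact ⟨h.1, by omega⟩
      have hlow : ∀ e < 2 ^ k, (P e ∧ (κ ∈ S → ptOfNat m e κ + g κ (ptOfNat m e) = 1) ↔
          P e ∧ 1 + g κ (ptOfNat m e) = 1) := by
        intro e he
        have : ptOfNat m e κ = 1 := by simp [ptOfNat, hκ, Nat.testBit_lt_two_pow he]
        simp [hS, this]
      have hhigh : ∀ e < 2 ^ k,
          (P e ∧ (κ ∈ S → ptOfNat m (2 ^ k + e) κ + g κ (ptOfNat m (2 ^ k + e)) = 1) ↔
          P e ∧ ¬ 1 + g κ (ptOfNat m e) = 1) := by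
        intro e he
        have : ptOfNat m (2 ^ k + e) κ = 0 := by
          simp [ptOfNat, hκ, Nat.testBit_two_pow_add_eq, Nat.testBit_lt_two_pow he]
        rw [this, hgk e κ le_rfl, ZMod.two_zero_add_iff]
        simp only [hS, true_imp_iff]
      rw [count_congr_of_lt hlow, count_congr_of_lt hhigh, hfilter,
        card_insert_of_notMem (by simp [hκ]), pow_succ, ← mul_assoc]
      have hadd : Nat.count (fun e => P e ∧ 1 + g κ (ptOfNat m e) = 1) (2 ^ k)
          + Nat.count (fun e => P e ∧ ¬ 1 + g κ (ptOfNat m e) = 1) (2 ^ k)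
          = Nat.count P (2 ^ k) := by
        simp only [Nat.count_eq_card_filter_range, ← filter_filter]
        exact card_filter_add_card_filter_not _
      rw [hadd, ih]; ring
    · have hfilter : (S.filter fun j : Fin m => (j : ℕ) < k + 1) = S.filter fun j : Fin m => (j : ℕ) < k := by
        refine filter_congr fun j hj => ⟨fun h => ?_, fun h => by omega⟩
        have : (j : ℕ) ≠ k := fun h' => hS (by rwa [show κ = j from Fin.ext h'.symm])
        omega
      simp only [hS, false_imp_iff, and_true]
      rw [hfilter, add_mul, ih]

theorem wtIn_eq_add_of_mem_Tset {m : ℕ} {S : Finset (Fin m)} (hne : S.Nonempty) {p : BPoly m}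
    (hp : p ∈ Tset S) {a : ℕ} (ha1 : 2 ^ ((S.max' hne : ℕ) + 1) ≤ a) (ha2 : a ≤ 2 ^ m) :
    wtIn p 1 a = 2 ^ ((S.max' hne : ℕ) + 1 - S.card)
      + wtIn p 1 (a - 2 ^ ((S.max' hne : ℕ) + 1)) := by
  obtain ⟨c, c0, rfl⟩ := hp
  set n := (S.max' hne : ℕ) + 1 with hn
  have hlt : ∀ j ∈ S, (j : ℕ) < n := fun j hj => Nat.lt_succ_of_le (S.le_max' j hj)
  obtain ⟨b, rfl⟩ := Nat.exists_eq_add_of_le ha1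
  let g : Fin m → Pt m → ZMod 2 := fun j x =>
    (∑ k ∈ Finset.univ.filter (fun k => k < j ∧ k ∉ S), c j k * x k) + c0 j
  have hg : ∀ j x y, (∀ i < j, x i = y i) → g j x = g j y := by
    intro j x y h
    refine congrArg (· + c0 j) (Finset.sum_congr rfl fun i hi => ?_)
    rw [h i (mem_filter.1 hi).2.1]
  have hiff : ∀ x : Pt m, (∏ j ∈ S, (x j +
      (∑ k ∈ Finset.univ.filter (fun k => k < j ∧ k ∉ S), c j k * x k) + c0 j)) = 1 ↔
      ∀ j ∈ S, (j : ℕ) < n → x j + g j x = 1 := by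
    intro x
    rw [← ZMod.two_ne_zero_iff, Finset.prod_ne_zero_iff]
    refine forall_congr' fun j => imp_congr_right fun hj => ?_
    rw [ZMod.two_ne_zero_iff, add_assoc]
    exact ⟨fun h _ => h, fun h => h (hlt j hj)⟩
  rw [wtIn_one_eq_count _ ha2, Nat.add_sub_cancel_left, wtIn_one_eq_count _ (le_of_add_le_right ha2)]
  simp only [hiff]
  rw [Nat.count_add]
  have hfull := count_triangular S g hg n (S.max' hne).isLt
  rw [filter_true_of_mem hlt] at hfull
  have hcard : S.card ≤ n := by
    have := Finset.card_le_card_of_injOn (s := S) (t := range n) (fun j : Fin m => (j : ℕ))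
      (fun j hj => by simpa using hlt j hj) (fun _ _ _ _ h => Fin.ext h)
    simpa using this
  congr 1
  · refine Nat.eq_of_mul_eq_mul_right (pow_pos two_pos S.card) ?_
    rw [hfull, ← pow_add, Nat.sub_add_cancel hcard]
  · refine count_congr_of_lt fun e _ => ?_
    refine forall_congr' fun j => imp_congr_right fun _ => imp_congr_right fun hj => ?_
    rw [ptOfNat_two_pow_add_of_lt e hj,
      hg j _ _ fun i hi => ptOfNat_two_pow_add_of_lt e (lt_trans hi hj)]

/-- for f = x_{i_1}⋯x_{i_t}, t ≥ 2, i_t = max S + 1 (1-based):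
for 2^{i_t} < a ≤ 2^m, N_f(w,a) = N_f(w − 2^{i_t-t}, a − 2^{i_t}) when
w ≥ 2^{i_t-t}, and N_f(w,a) = 0 when w < 2^{i_t-t}. -/
theorem stmt9 (m : ℕ) (hm : 1 ≤ m) (S : Finset (Fin m)) (hS : 2 ≤ S.card)
    (hne : S.Nonempty) (a : ℕ)
    (ha1 : 2 ^ ((S.max' hne : ℕ) + 1) < a) (ha2 : a ≤ 2 ^ m) :
    (∀ w : ℕ, 2 ^ ((S.max' hne : ℕ) + 1 - S.card) ≤ w →
        Nfun S w a =
          Nfun S (w - 2 ^ ((S.max' hne : ℕ) + 1 - S.card)) (a - 2 ^ ((S.max' hne : ℕ) + 1))) ∧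
    (∀ w : ℕ, w < 2 ^ ((S.max' hne : ℕ) + 1 - S.card) → Nfun S w a = 0) := by
  have key : ∀ p ∈ Tset S, _ := fun p hp => wtIn_eq_add_of_mem_Tset hne hp ha1.le ha2
  refine ⟨fun w hw => congrArg Set.ncard (Set.ext fun p => and_congr_right fun hp => ?_),
    fun w hw => ?_⟩
  · have := key p hp
    omega
  · rw [Nfun, Set.ncard_eq_zero, Set.eq_empty_iff_forall_notMem]
    rintro p ⟨hp, h⟩
    have := key p hp
    omega
end

section
/- Let f be a monomial of degree r in x_1,…,x_m and let 0 ≤ i ≤ N. Then the number of p ∈ T(f) whose evaluation vector vanishes on the last i positions {N−i+1,…,N} equals the number of p ∈ T(f) whose evaluation vector vanishes on the first i positions {1,…,i}. Equivalently, since each p ∈ T(f) has wt(p) = 2^{m−r}, the number of p ∈ T(f) surviving Wang-Liu shortening of the last i bits equals P_f(2^{m−r}, i) := |{p ∈ T(f) : wt(p_{[i+1,N]}) = 2^{m−r}}|. -/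
open Finset

theorem Dnat_add_Dnat_add_one {m : ℕ} (a : Pt m) :
    Dnat a + Dnat (a + 1) = 2 ^ m + 1 := by
  have hval : ∀ z : ZMod 2, (1 - z.val) + (1 - (z + 1).val) = 1 := by decide
  have hgeom : ∑ i : Fin m, 2 ^ (i : ℕ) + 1 = 2 ^ m := by
    rw [Fin.sum_univ_eq_sum_range (fun i => 2 ^ i) m]
    have := Nat.geomSum_eq (le_refl 2) m
    have hp : 0 < 2 ^ m := by positivity
    simp only [this]
    omega
  have hsum : (∑ i : Fin m, 2 ^ (i : ℕ) * (1 - (a i).val)) +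
      (∑ i : Fin m, 2 ^ (i : ℕ) * (1 - ((a + 1) i).val)) = ∑ i : Fin m, 2 ^ (i : ℕ) := by
    rw [← Finset.sum_add_distrib]
    refine Finset.sum_congr rfl fun i _ => ?_
    rw [← Nat.mul_add, Pi.add_apply, Pi.one_apply, hval, mul_one]
  unfold Dnat
  omega

theorem add_one_add_one {m : ℕ} (a : Pt m) : a + 1 + 1 = a := by
  funext i
  simp only [Pi.add_apply, Pi.one_apply, add_assoc, CharTwo.add_self_eq_zero, add_zero]

theorem comp_add_one_mem_Tset {m : ℕ} {S : Finset (Fin m)} {p : BPoly m} (hp : p ∈ Tset S) :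
    (fun a => p (a + 1)) ∈ Tset S := by
  obtain ⟨c, c0, rfl⟩ := hp
  refine ⟨c, fun j => c0 j + 1 + ∑ k ∈ univ.filter (fun k => k < j ∧ k ∉ S), c j k, ?_⟩
  funext x
  refine Finset.prod_congr rfl fun j _ => ?_
  simp only [Pi.add_apply, Pi.one_apply, mul_add, mul_one, Finset.sum_add_distrib]
  ring

theorem card_filter_forall_mem_eq_one {m : ℕ} (S : Finset (Fin m)) :
    (univ.filter (fun y : Pt m => ∀ j ∈ S, y j = 1)).card = 2 ^ (m - S.card) := by
  have h : univ.filter (fun y : Pt m => ∀ j ∈ S, y j = 1) =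
      Fintype.piFinset (fun j => if j ∈ S then ({1} : Finset (ZMod 2)) else univ) := by
    ext y
    simp only [mem_filter, mem_univ, true_and, Fintype.mem_piFinset]
    refine forall_congr' fun j => ?_
    by_cases hj : j ∈ S <;> simp [hj]
  rw [h, Fintype.card_piFinset]
  have hc : ∀ j, (if j ∈ S then ({1} : Finset (ZMod 2)) else univ).card =
      if j ∈ S then 1 else 2 := by
    intro j
    split_ifs <;> simp [ZMod.card]
  simp only [hc]
  rw [Finset.prod_ite]
  simp [← compl_filter, Finset.card_compl]

theorem wt_of_mem_Tset {m : ℕ} {S : Finset (Fin m)} {p : BPoly m} (hp : p ∈ Tset S) :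
    wt p = 2 ^ (m - S.card) := by
  obtain ⟨c, c0, rfl⟩ := hp
  rw [← card_filter_forall_mem_eq_one S, wt]
  set shear : Pt m → Pt m := fun x j => if j ∈ S then
    x j + (∑ k ∈ univ.filter (fun k => k < j ∧ k ∉ S), c j k * x k) + c0 j else x j
    with hshear
  have hout : ∀ x j, j ∉ S → shear x j = x j := fun x j hj => by simp [hshear, hj]
  have hin : ∀ x j, j ∈ S → shear x j =
      x j + (∑ k ∈ univ.filter (fun k => k < j ∧ k ∉ S), c j k * x k) + c0 j :=
    fun x j hj => by simp [hshear, hj]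
  have hinv : Function.Involutive shear := by
    intro x
    funext j
    by_cases hj : j ∈ S
    · have hs : ∑ k ∈ univ.filter (fun k => k < j ∧ k ∉ S), c j k * shear x k =
          ∑ k ∈ univ.filter (fun k => k < j ∧ k ∉ S), c j k * x k :=
        Finset.sum_congr rfl fun k hk => by rw [hout x k (mem_filter.mp hk).2.2]
      rw [hin _ _ hj, hs, hin _ _ hj]
      generalize ∑ k ∈ univ.filter (fun k => k < j ∧ k ∉ S), c j k * x k = s
      calc x j + s + c0 j + s + c0 j = x j + (s + s) + (c0 j + c0 j) := by ring
        _ = x j := by simp only [CharTwo.add_self_eq_zero, add_zero]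
    · rw [hout _ _ hj, hout _ _ hj]
  have hone : ∀ z : ZMod 2, z ≠ 0 ↔ z = 1 := by decide
  refine Finset.card_equiv hinv.toPerm fun x => ?_
  simp only [mem_filter, mem_univ, true_and, Function.Involutive.coe_toPerm]
  rw [← hone, Finset.prod_ne_zero_iff]
  exact forall₂_congr fun j hj => by rw [hone, hin x j hj]

theorem wtIn_eq_wt_iff {m : ℕ} (p : BPoly m) (i : ℕ) :
    wtIn p (i + 1) (2 ^ m) = wt p ↔ ∀ a : Pt m, Dnat a ≤ i → p a = 0 := by
  have hone : ∀ z : ZMod 2, z ≠ 0 → z = 1 := by decide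
  have hle : ∀ a : Pt m, Dnat a ≤ 2 ^ m := fun a => by
    have h := Dnat_add_Dnat_add_one a
    have : 1 ≤ Dnat (a + 1) := Nat.le_add_left _ _
    omega
  have hsub : univ.filter (fun a : Pt m => i + 1 ≤ Dnat a ∧ Dnat a ≤ 2 ^ m ∧ p a = 1) ⊆
      univ.filter (fun a : Pt m => p a = 1) :=
    Finset.monotone_filter_right _ fun a _ h => h.2.2
  unfold wtIn wt
  constructor
  · intro h a ha
    by_contra hne
    have hmem : a ∈ univ.filter (fun a : Pt m => p a = 1) := by simp [hone _ hne]
    rw [← Finset.eq_of_subset_of_card_le hsub h.ge] at hmem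
    have := (mem_filter.mp hmem).2.1
    omega
  · intro h
    congr 1
    refine hsub.antisymm fun a ha => ?_
    have hpa : p a = 1 := (mem_filter.mp ha).2
    refine mem_filter.mpr ⟨mem_univ _, ?_, hle a, hpa⟩
    by_contra hlt
    have := h a (by omega)
    rw [hpa] at this
    exact one_ne_zero this

theorem ncard_vanishing_last_eq_ncard_vanishing_first {m : ℕ} (S : Finset (Fin m)) {i : ℕ}
    (hi : i ≤ 2 ^ m) :
    {p : BPoly m | p ∈ Tset S ∧ ∀ a : Pt m, 2 ^ m - i < Dnat a → p a = 0}.ncard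
      = {p : BPoly m | p ∈ Tset S ∧ ∀ a : Pt m, Dnat a ≤ i → p a = 0}.ncard := by
  refine Set.ncard_congr (fun p _ a => p (a + 1)) ?_ ?_ ?_
  · rintro p ⟨hp, hv⟩
    refine ⟨comp_add_one_mem_Tset hp, fun a ha => hv _ ?_⟩
    have := Dnat_add_Dnat_add_one a
    omega
  · intro p q _ _ h
    funext a
    simpa only [add_one_add_one] using congrFun h (a + 1)
  · rintro q ⟨hq, hv⟩
    refine ⟨fun a => q (a + 1), ⟨comp_add_one_mem_Tset hq, fun a ha => hv _ ?_⟩, ?_⟩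
    · have := Dnat_add_Dnat_add_one a
      omega
    · funext a
      simp only [add_one_add_one]

/-- for a degree-r monomial f and 0 ≤ i ≤ N, the number of p ∈ T(f)
vanishing on the last i positions {N−i+1,…,N} equals the number of p ∈ T(f)
vanishing on the first i positions {1,…,i}; equivalently, the number of p ∈ T(f)
surviving Wang-Liu shortening of the last i bits equals P_f(2^{m−r}, i). -/
theorem stmt14 (m r : ℕ) (hm : 1 ≤ m) (S : Finset (Fin m)) (hS : S.card = r)
    (i : ℕ) (hi : i ≤ 2 ^ m) :
    {p : BPoly m | p ∈ Tset S ∧ ∀ a : Pt m, 2 ^ m - i < Dnat a → p a = 0}.ncard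
        = {p : BPoly m | p ∈ Tset S ∧ ∀ a : Pt m, Dnat a ≤ i → p a = 0}.ncard ∧
      {p : BPoly m | p ∈ Tset S ∧ ∀ a : Pt m, 2 ^ m - i < Dnat a → p a = 0}.ncard
        = Pf S (2 ^ (m - r)) i := by
  have h := ncard_vanishing_last_eq_ncard_vanishing_first S hi
  refine ⟨h, h.trans ?_⟩
  unfold Pf
  congr 1
  ext p
  refine and_congr_right fun hp => ?_
  rw [← hS, ← wt_of_mem_Tset hp, wtIn_eq_wt_iff]
end
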